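/- Fix X ∈ 𝒜′ and let 𝐀 be a block matrix all of whose entries lie in 𝒜. Then 𝐀 is block Toeplitz if and only if there exist block column vectors A = (A_0,…,A_{n−1})ᵗ and B = (B_0,…,B_{n−1})ᵗ with entries in M_d(ℂ) such that 𝐀 − 𝐒_X 𝐀 𝐒_X* = AP₀ + P₀*B*, where B* is the 1×n block row with k-th entry (B_k)*. -/

import Mathlib

open Matrix BigOperators

noncomputable section

/-- A block entry: a `d × d` complex matrix. -/
abbrev Blk (d : ℕ) := Matrix (Fin d) (Fin d) ℂ

/-- An `n × n` block matrix with `d × d` complex matrix entries. -/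
abbrev BlkMat (n d : ℕ) := Matrix (Fin n) (Fin n) (Blk d)

/-- A block column vector: an `n × 1` column of `d × d` complex matrices. -/
abbrev BlkVec (n d : ℕ) := Fin n → Blk d

/-- The block shift `𝐒`: identity blocks on the subdiagonal, zero elsewhere. -/
def Smat (n d : ℕ) : BlkMat n d :=
  Matrix.of fun i j => if (i : ℕ) = (j : ℕ) + 1 then (1 : Blk d) else 0

/-- `𝐒_X`: identity blocks on the subdiagonal, `X` in the corner entry `(1, n)`
(zero-based `(0, n-1)`), zero elsewhere. -/
def SX (n d : ℕ) (X : Blk d) : BlkMat n d :=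
  Matrix.of fun i j =>
    if (i : ℕ) = (j : ℕ) + 1 then (1 : Blk d)
    else if (i : ℕ) = 0 ∧ (j : ℕ) = n - 1 then X else 0

/-- A block matrix is block Toeplitz when entries depend only on the difference of indices. -/
def IsBlockToeplitz {n d : ℕ} (A : BlkMat n d) : Prop :=
  ∀ i j i' j' : Fin n, (i : ℤ) - (j : ℤ) = (i' : ℤ) - (j' : ℤ) → A i j = A i' j'

/-- `T(A, Ω)`: the block Toeplitz matrix with zero diagonal whose `(i,j)` entry is
`A_{i-j}` for `i > j` and `(Ω_{j-i})ᴴ` for `i < j`. -/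
def Tmat {n d : ℕ} (A Ω : BlkVec n d) : BlkMat n d :=
  Matrix.of fun i j =>
    if (j : ℕ) < (i : ℕ) then
      A ⟨(i : ℕ) - (j : ℕ), (Nat.sub_le _ _).trans_lt i.isLt⟩
    else if (i : ℕ) < (j : ℕ) then
      (Ω ⟨(j : ℕ) - (i : ℕ), (Nat.sub_le _ _).trans_lt j.isLt⟩)ᴴ
    else 0

/-- `Ã`: the block column vector with `Ã_0 = 0` and `Ã_k = (A_{n-k})ᴴ` for `1 ≤ k ≤ n-1`. -/
def tilde {n d : ℕ} (A : BlkVec n d) : BlkVec n d :=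
  fun k =>
    if h : (k : ℕ) = 0 then 0
    else (A ⟨n - (k : ℕ),
      Nat.sub_lt ((Nat.zero_le _).trans_lt k.isLt) (Nat.pos_of_ne_zero h)⟩)ᴴ

/-- `U V*`: the `n × n` block matrix with `(i,j)` entry `U_i (V_j)ᴴ`. -/
def outer {n d : ℕ} (U V : BlkVec n d) : BlkMat n d :=
  Matrix.of fun i j => U i * (V j)ᴴ

/-- `v P₀`: the block matrix whose first block column is `v` and all other entries `0`. -/
def colTimesP0 {n d : ℕ} (v : BlkVec n d) : BlkMat n d :=
  Matrix.of fun i j => if (j : ℕ) = 0 then v i else 0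

/-- `P₀* w`: the block matrix whose first block row is `w` and all other entries `0`. -/
def P0starRow {n d : ℕ} (w : BlkVec n d) : BlkMat n d :=
  Matrix.of fun i j => if (i : ℕ) = 0 then w j else 0

/-- The block column vector with `M` in its first entry and `0` elsewhere. -/
def e0 {n d : ℕ} (M : Blk d) : BlkVec n d :=
  fun i => if (i : ℕ) = 0 then M else 0

theorem SX_mul_succ {n d : ℕ} (X : Blk d) (M : BlkMat n d) (i : ℕ) (hi : i + 1 < n) (j : Fin n) :
    (SX n d X * M) ⟨i + 1, hi⟩ j = M ⟨i, by omega⟩ j := by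
  rw [Matrix.mul_apply, Finset.sum_eq_single (⟨i, by omega⟩ : Fin n)]
  · simp [SX]
  · intro b _ hb
    have h : ¬ (i = (b : ℕ)) := fun h => hb (Fin.ext h.symm)
    simp [SX, h]
  · simp

theorem mul_star_SX_succ {n d : ℕ} (X : Blk d) (M : BlkMat n d) (i : Fin n) (j : ℕ)
    (hj : j + 1 < n) :
    (M * star (SX n d X)) i ⟨j + 1, hj⟩ = M i ⟨j, by omega⟩ := by
  rw [Matrix.mul_apply, Finset.sum_eq_single (⟨j, by omega⟩ : Fin n)]
  · simp [SX, Matrix.star_apply]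
  · intro b _ hb
    have h : ¬ (j = (b : ℕ)) := fun h => hb (Fin.ext h.symm)
    simp [SX, h, Matrix.star_apply]
  · simp

theorem displacement_succ {n d : ℕ} (X : Blk d) (A : BlkMat n d) (i j : ℕ)
    (hi : i + 1 < n) (hj : j + 1 < n) :
    (A - SX n d X * A * star (SX n d X)) ⟨i + 1, hi⟩ ⟨j + 1, hj⟩
      = A ⟨i + 1, hi⟩ ⟨j + 1, hj⟩ - A ⟨i, by omega⟩ ⟨j, by omega⟩ := by
  rw [Matrix.sub_apply, mul_star_SX_succ, SX_mul_succ]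

theorem toeplitz_shift {n d : ℕ} (A : BlkMat n d)
    (h : ∀ (i j : ℕ) (hi : i + 1 < n) (hj : j + 1 < n),
      A ⟨i + 1, hi⟩ ⟨j + 1, hj⟩ = A ⟨i, by omega⟩ ⟨j, by omega⟩)
    (k i j : ℕ) (hi : i + k < n) (hj : j + k < n) :
    A ⟨i + k, hi⟩ ⟨j + k, hj⟩ = A ⟨i, by omega⟩ ⟨j, by omega⟩ := by
  induction k with
  | zero => rfl
  | succ k ih => exact (h (i + k) (j + k) hi hj).trans (ih (by omega) (by omega))

/-- `𝐀` with entries in `𝒜` is block Toeplitz iff there exist block column vectors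
`A`, `B` with `𝐀 − 𝐒_X 𝐀 𝐒_X* = AP₀ + P₀*B*`. -/
theorem toeplitz_iff_SX_displacement (n d : ℕ) (hn : 0 < n) (hd : 0 < d)
    (𝒜 : Subalgebra ℂ (Blk d)) (hcomm : ∀ a ∈ 𝒜, ∀ b ∈ 𝒜, a * b = b * a)
    (X : Blk d) (hX : ∀ a ∈ 𝒜, X * a = a * X)
    (A : BlkMat n d) (hAmem : ∀ i j, A i j ∈ 𝒜) :
    IsBlockToeplitz A ↔
      ∃ V W : BlkVec n d,
        A - SX n d X * A * star (SX n d X)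
          = colTimesP0 V + P0starRow (fun k => (W k)ᴴ) := by
  constructor
  · intro hT
    refine ⟨fun i => if (i : ℕ) = 0 then 0 else
        (A - SX n d X * A * star (SX n d X)) i ⟨0, hn⟩,
      fun j => ((A - SX n d X * A * star (SX n d X)) ⟨0, hn⟩ j)ᴴ, ?_⟩
    refine Matrix.ext fun i j => ?_
    generalize hD : A - SX n d X * A * star (SX n d X) = D
    obtain ⟨i, hi⟩ := i
    obtain ⟨j, hj⟩ := j
    rcases i with _ | i
    · simp [colTimesP0, P0starRow]
    · rcases j with _ | j
      · simp [colTimesP0, P0starRow]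
      · have h1 : D ⟨i + 1, hi⟩ ⟨j + 1, hj⟩ = 0 := by
          rw [← hD, displacement_succ, sub_eq_zero]
          apply hT
          push_cast
          ring
        rw [h1]
        simp [colTimesP0, P0starRow]
  · rintro ⟨V, W, h⟩
    have hs : ∀ (i j : ℕ) (hi : i + 1 < n) (hj : j + 1 < n),
        A ⟨i + 1, hi⟩ ⟨j + 1, hj⟩ = A ⟨i, by omega⟩ ⟨j, by omega⟩ := by
      intro i j hi hj
      rw [← sub_eq_zero, ← displacement_succ X, h]
      simp [colTimesP0, P0starRow]
    rintro ⟨i, hi⟩ ⟨j, hj⟩ ⟨i', hi'⟩ ⟨j', hj'⟩ e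
    simp only at e
    rcases le_total i i' with hle | hle
    · obtain ⟨k, rfl⟩ := Nat.exists_eq_add_of_le hle
      obtain rfl : j' = j + k := by omega
      exact (toeplitz_shift A hs k i j hi' hj').symm
    · obtain ⟨k, rfl⟩ := Nat.exists_eq_add_of_le hle
      obtain rfl : j = j' + k := by omega
      exact toeplitz_shift A hs k i' j' hi hj
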